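/- arXiv:2310.20501 — 3 statements merged into one kernel-verified Lean document; each statement's English description precedes it below -/
import Mathlib

section
/- Conditional-redundancy step in the proof of Theorem A.1: let d^H : Fin S → Σ be a fixed document, let H and H' be autoregressive models over Σ of length S, and let L be an autoregressive model over Σ of length S. Assume Conditional Redundancy: for every document d : Fin S → Σ, PPL(d, H') ≤ PPL(d^H, H). Then ∑_{d : Fin S → Σ} P_L(d) · PPL(d, L) − PPL(d^H, H) ≤ −(1/S) · ∑_{s < S} ∑_{p : Fin s → Σ} π_L(p) · D_KL( L_s(·|p) ‖ H'_s(·|p) ). -/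
open Finset

/-- An autoregressive model over a finite token alphabet `Tok` of length `S`:
for each position `s < S` and each prefix `p : Fin s → Tok`, a strictly positive
conditional probability mass function on `Tok`. -/
structure ARModel (Tok : Type*) [Fintype Tok] (S : ℕ) where
  prob : ∀ s : Fin S, (Fin s → Tok) → Tok → ℝ
  prob_pos : ∀ (s : Fin S) (p : Fin s → Tok) (x : Tok), 0 < prob s p x
  sum_prob : ∀ (s : Fin S) (p : Fin s → Tok), ∑ x, prob s p x = 1

/-- The prefix `(d_0, …, d_{s-1})` of a document `d`. -/
def prefixOf {Tok : Type*} {S : ℕ} (d : Fin S → Tok) (s : Fin S) : Fin s → Tok :=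
  fun t => d ⟨t.1, t.2.trans s.isLt⟩

/-- Joint probability of a document `d` under the autoregressive model `M`. -/
noncomputable def joint {Tok : Type*} [Fintype Tok] {S : ℕ}
    (M : ARModel Tok S) (d : Fin S → Tok) : ℝ :=
  ∏ s : Fin S, M.prob s (prefixOf d s) (d s)

/-- Log-perplexity of a document `d` under the autoregressive model `M`. -/
noncomputable def ppl {Tok : Type*} [Fintype Tok] {S : ℕ}
    (M : ARModel Tok S) (d : Fin S → Tok) : ℝ :=
  -(1 / (S : ℝ)) * ∑ s : Fin S, Real.log (M.prob s (prefixOf d s) (d s))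

/-- Marginal probability of a prefix `p : Fin s → Tok` under the model `M`. -/
noncomputable def prefixMarginal {Tok : Type*} [Fintype Tok] {S : ℕ}
    (M : ARModel Tok S) (s : Fin S) (p : Fin s → Tok) : ℝ :=
  ∏ t : Fin s, M.prob ⟨t.1, t.2.trans s.isLt⟩ (fun u => p ⟨u.1, u.2.trans t.2⟩) (p t)

/-- Kullback–Leibler divergence between two (strictly positive) probability
vectors on `Tok`. -/
noncomputable def klDiv {Tok : Type*} [Fintype Tok] (p q : Tok → ℝ) : ℝ :=
  ∑ x, p x * Real.log (p x / q x)

/-- Probability of a prefix of arbitrary length `n ≤ S` under the model `M`. -/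
noncomputable def initialProb {Tok : Type*} [Fintype Tok] {S : ℕ}
    (M : ARModel Tok S) (n : ℕ) (hn : n ≤ S) (p : Fin n → Tok) : ℝ :=
  ∏ t : Fin n, M.prob ⟨t.1, t.2.trans_le hn⟩ (fun u => p ⟨u.1, u.2.trans t.2⟩) (p t)

lemma initialProb_snoc {Tok : Type*} [Fintype Tok] {S : ℕ} (M : ARModel Tok S)
    (n : ℕ) (hn : n + 1 ≤ S) (p : Fin n → Tok) (x : Tok) :
    initialProb M (n + 1) hn (Fin.snoc (α := fun _ => Tok) p x)
      = initialProb M n (Nat.le_of_succ_le hn) p * M.prob ⟨n, hn⟩ p x := by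
  have key : ∀ (k : ℕ) (hk : k < n),
      Fin.snoc (α := fun _ => Tok) p x ⟨k, hk.trans n.lt_succ_self⟩ = p ⟨k, hk⟩ := by
    intro k hk
    exact Fin.snoc_castSucc (α := fun _ => Tok) x p ⟨k, hk⟩
  unfold initialProb
  rw [Fin.prod_univ_castSucc]
  congr 1
  · refine Finset.prod_congr rfl fun t _ => ?_
    rw [Fin.snoc_castSucc]
    congr 1
    funext u
    exact key u.1 (u.2.trans t.2)
  · rw [Fin.snoc_last]
    congr 1
    funext u
    exact key u.1 u.2

lemma sum_initialProb_succ {Tok : Type*} [Fintype Tok] {S : ℕ} (M : ARModel Tok S)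
    (n : ℕ) (hn : n + 1 ≤ S) (f : (Fin (n + 1) → Tok) → ℝ) :
    ∑ q : Fin (n + 1) → Tok, initialProb M (n + 1) hn q * f q
      = ∑ p : Fin n → Tok, initialProb M n (Nat.le_of_succ_le hn) p *
          ∑ x, M.prob ⟨n, hn⟩ p x * f (Fin.snoc (α := fun _ => Tok) p x) := by
  rw [← (Fin.snocEquiv fun _ : Fin (n + 1) => Tok).sum_comp, Fintype.sum_prod_type_right]
  refine Finset.sum_congr rfl fun p _ => ?_
  rw [Finset.mul_sum]
  refine Finset.sum_congr rfl fun x _ => ?_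
  rw [← mul_assoc, ← initialProb_snoc]
  rfl

lemma sum_initialProb_restrict {Tok : Type*} [Fintype Tok] {S : ℕ} (M : ARModel Tok S)
    {n k : ℕ} (hnk : n ≤ k) (hk : k ≤ S) (f : (Fin n → Tok) → ℝ) :
    ∑ q : Fin k → Tok, initialProb M k hk q * f (fun u => q ⟨u.1, u.2.trans_le hnk⟩)
      = ∑ p : Fin n → Tok, initialProb M n (hnk.trans hk) p * f p := by
  induction k, hnk using Nat.le_induction with
  | base => rfl
  | succ k hnk ih =>
    rw [sum_initialProb_succ, ← ih (Nat.le_of_succ_le hk)]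
    refine Finset.sum_congr rfl fun p _ => ?_
    have key : ∀ x : Tok, (fun u : Fin n => Fin.snoc (α := fun _ => Tok) p x
        ⟨u.1, u.2.trans_le (hnk.trans k.le_succ)⟩) = fun u => p ⟨u.1, u.2.trans_le hnk⟩ := by
      intro x
      funext u
      exact Fin.snoc_castSucc (α := fun _ => Tok) x p ⟨u.1, u.2.trans_le hnk⟩
    simp only [key]
    rw [← Finset.sum_mul, M.sum_prob, one_mul]

lemma sum_joint {Tok : Type*} [Fintype Tok] {S : ℕ} (M : ARModel Tok S) :
    ∑ d : Fin S → Tok, joint M d = 1 := by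
  have h := sum_initialProb_restrict M (Nat.zero_le S) le_rfl fun _ => 1
  simp only [mul_one] at h
  refine Eq.trans h ?_
  simp [initialProb]

lemma joint_pos {Tok : Type*} [Fintype Tok] {S : ℕ} (M : ARModel Tok S) (d : Fin S → Tok) :
    0 < joint M d :=
  Finset.prod_pos fun _ _ => M.prob_pos _ _ _

/-- The expectation under `M` of a function of the prefix before position `s` and the token at
position `s`. -/
lemma sum_joint_mul {Tok : Type*} [Fintype Tok] {S : ℕ} (M : ARModel Tok S) (s : Fin S)
    (f : (Fin s → Tok) → Tok → ℝ) :
    ∑ d : Fin S → Tok, joint M d * f (prefixOf d s) (d s)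
      = ∑ p : Fin s → Tok, prefixMarginal M s p * ∑ x, M.prob s p x * f p x := by
  have h := sum_initialProb_restrict M (Nat.succ_le_of_lt s.isLt) le_rfl
    fun q => f (fun u => q u.castSucc) (q (Fin.last s))
  refine Eq.trans h ?_
  rw [sum_initialProb_succ]
  refine Finset.sum_congr rfl fun p _ => ?_
  simp only [Fin.snoc_castSucc, Fin.snoc_last]
  rfl

/-- Conditional-redundancy step in the proof of Theorem A.1. -/
theorem conditional_redundancy_step {Tok : Type*} [Fintype Tok] [DecidableEq Tok] [Nonempty Tok]
    {S : ℕ} (hS : 1 ≤ S) (dH : Fin S → Tok) (H H' L : ARModel Tok S)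
    (hCR : ∀ d : Fin S → Tok, ppl H' d ≤ ppl H dH) :
    ∑ d : Fin S → Tok, joint L d * ppl L d - ppl H dH
      ≤ -(1 / (S : ℝ)) * ∑ s : Fin S, ∑ p : Fin s → Tok,
          prefixMarginal L s p * klDiv (L.prob s p) (H'.prob s p) := by
  have hppl : ∀ d, ppl L d - ppl H' d = -(1 / (S : ℝ)) * ∑ s : Fin S,
      Real.log (L.prob s (prefixOf d s) (d s) / H'.prob s (prefixOf d s) (d s)) := by
    intro d
    rw [ppl, ppl, ← mul_sub, ← Finset.sum_sub_distrib]
    congr 1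
    refine Finset.sum_congr rfl fun s _ => ?_
    rw [Real.log_div (L.prob_pos _ _ _).ne' (H'.prob_pos _ _ _).ne']
  calc ∑ d : Fin S → Tok, joint L d * ppl L d - ppl H dH
      = ∑ d : Fin S → Tok, joint L d * (ppl L d - ppl H dH) := by
        simp only [mul_sub, Finset.sum_sub_distrib]
        rw [← Finset.sum_mul, sum_joint, one_mul]
    _ ≤ ∑ d : Fin S → Tok, joint L d * (ppl L d - ppl H' d) :=
        Finset.sum_le_sum fun d _ => mul_le_mul_of_nonneg_left
          (sub_le_sub_left (hCR d) _) (joint_pos L d).le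
    _ = -(1 / (S : ℝ)) * ∑ s : Fin S, ∑ d : Fin S → Tok, joint L d *
          Real.log (L.prob s (prefixOf d s) (d s) / H'.prob s (prefixOf d s) (d s)) := by
        rw [Finset.sum_comm, Finset.mul_sum]
        refine Finset.sum_congr rfl fun d _ => ?_
        rw [hppl, ← Finset.mul_sum, mul_left_comm]
    _ = _ := by
        congr 1
        refine Finset.sum_congr rfl fun s _ => ?_
        exact sum_joint_mul L s fun p x => Real.log (L.prob s p x / H'.prob s p x)
end

section
/- Penultimate bound in the proof of Theorem A.1: let d^H : Fin S → Σ be a fixed document, and let B, H, B', H', L be autoregressive models over Σ of length S. Assume Semantic Superiority: PPL(d^H, H) ≤ PPL(d^H, B); and Conditional Redundancy: for every document d : Fin S → Σ, PPL(d, H') ≤ PPL(d^H, H). Then ∑_{d : Fin S → Σ} P_L(d) · ( PPL(d, B) − PPL(d^H, B) ) ≤ ∑_{d : Fin S → Σ} P_L(d) · ( PPL(d, B) − PPL(d, B') ) + (1/S) · ∑_{s < S} ∑_{p : Fin s → Σ} π_L(p) · ( D_KL( L_s(·|p) ‖ B'_s(·|p) ) − D_KL( L_s(·|p) ‖ H'_s(·|p)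 ) ). -/
open Finset

/-- Probability that a document sampled from `M` starts with `p`, for any length `k ≤ S`. -/
noncomputable def prefixWeight {Tok : Type*} [Fintype Tok] {S : ℕ}
    (M : ARModel Tok S) (k : ℕ) (hk : k ≤ S) (p : Fin k → Tok) : ℝ :=
  ∏ t : Fin k, M.prob ⟨t.1, t.2.trans_le hk⟩ (fun u => p ⟨u.1, u.2.trans t.2⟩) (p t)

theorem prefixWeight_snoc {Tok : Type*} [Fintype Tok] {S : ℕ} (M : ARModel Tok S)
    (k : ℕ) (hk : k < S) (p : Fin k → Tok) (x : Tok) :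
    prefixWeight M (k + 1) hk (Fin.snoc (α := fun _ => Tok) p x)
      = prefixWeight M k hk.le p * M.prob ⟨k, hk⟩ p x := by
  unfold prefixWeight
  rw [Fin.prod_univ_castSucc]
  congr 1
  · refine Finset.prod_congr rfl fun t _ => ?_
    have h : ∀ u : Fin t.1, u.1 < k := fun u => u.2.trans t.2
    simp [Fin.snoc, h]
  · simp [Fin.snoc]

theorem sum_snoc {Tok : Type*} [Fintype Tok] {k : ℕ} (F : (Fin (k + 1) → Tok) → ℝ) :
    ∑ q, F q = ∑ p : Fin k → Tok, ∑ x, F (Fin.snoc (α := fun _ => Tok) p x) := by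
  rw [← (Fin.snocEquiv fun _ => Tok).sum_comp, Fintype.sum_prod_type, Finset.sum_comm]
  rfl

theorem sum_joint_mul_take {Tok : Type*} [Fintype Tok] {S : ℕ} (M : ARModel Tok S)
    (k : ℕ) (hk : k ≤ S) (f : (Fin k → Tok) → ℝ) :
    ∑ d : Fin S → Tok, joint M d * f (fun t => d ⟨t.1, t.2.trans_le hk⟩)
      = ∑ p, prefixWeight M k hk p * f p := by
  induction hk using Nat.decreasingInduction with
  | self => rfl
  | of_succ k hk ih =>
    have h := ih fun q => f (Fin.init (α := fun _ => Tok) q)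
    refine h.trans ?_
    rw [sum_snoc]
    refine Finset.sum_congr rfl fun p _ => ?_
    simp only [prefixWeight_snoc, Fin.init_snoc]
    rw [← Finset.sum_mul, ← Finset.mul_sum, M.sum_prob, mul_one]

theorem sum_joint_mul_step {Tok : Type*} [Fintype Tok] {S : ℕ} (M : ARModel Tok S)
    (s : Fin S) (g : (Fin s → Tok) → Tok → ℝ) :
    ∑ d : Fin S → Tok, joint M d * g (prefixOf d s) (d s)
      = ∑ p, prefixMarginal M s p * ∑ x, M.prob s p x * g p x := by
  refine (sum_joint_mul_take M (s.1 + 1) s.2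
    fun q => g (Fin.init (α := fun _ => Tok) q) (q (Fin.last _))).trans ?_
  rw [sum_snoc]
  refine Finset.sum_congr rfl fun p _ => ?_
  simp only [prefixWeight_snoc, Fin.init_snoc, Fin.snoc_last, Finset.mul_sum, mul_assoc]
  rfl

theorem klDiv_sub_klDiv {Tok : Type*} [Fintype Tok] {p q r : Tok → ℝ}
    (hp : ∀ x, 0 < p x) (hq : ∀ x, 0 < q x) (hr : ∀ x, 0 < r x) :
    klDiv p q - klDiv p r = ∑ x, p x * (Real.log (r x) - Real.log (q x)) := by
  unfold klDiv
  rw [← Finset.sum_sub_distrib]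
  refine Finset.sum_congr rfl fun x _ => ?_
  rw [Real.log_div (hp x).ne' (hq x).ne', Real.log_div (hp x).ne' (hr x).ne']
  ring

theorem sum_joint_mul_ppl_sub {Tok : Type*} [Fintype Tok] {S : ℕ} (L M N : ARModel Tok S) :
    ∑ d : Fin S → Tok, joint L d * (ppl M d - ppl N d)
      = (1 / (S : ℝ)) * ∑ s : Fin S, ∑ p : Fin s → Tok, prefixMarginal L s p *
          (klDiv (L.prob s p) (M.prob s p) - klDiv (L.prob s p) (N.prob s p)) := by
  simp_rw [klDiv_sub_klDiv (L.prob_pos _ _) (M.prob_pos _ _) (N.prob_pos _ _),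
    ← sum_joint_mul_step L _ fun p x => Real.log (N.prob _ p x) - Real.log (M.prob _ p x)]
  rw [Finset.sum_comm, Finset.mul_sum]
  refine Finset.sum_congr rfl fun d _ => ?_
  rw [← Finset.mul_sum, Finset.sum_sub_distrib]
  unfold ppl
  ring

/-- Penultimate bound in the proof of Theorem A.1. -/
theorem penultimate_bound {Tok : Type*} [Fintype Tok] [DecidableEq Tok] [Nonempty Tok]
    {S : ℕ} (hS : 1 ≤ S) (dH : Fin S → Tok) (B H B' H' L : ARModel Tok S)
    (hSS : ppl H dH ≤ ppl B dH)
    (hCR : ∀ d : Fin S → Tok, ppl H' d ≤ ppl H dH) :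
    ∑ d : Fin S → Tok, joint L d * (ppl B d - ppl B dH)
      ≤ ∑ d : Fin S → Tok, joint L d * (ppl B d - ppl B' d)
        + (1 / (S : ℝ)) * ∑ s : Fin S, ∑ p : Fin s → Tok,
            prefixMarginal L s p *
              (klDiv (L.prob s p) (B'.prob s p) - klDiv (L.prob s p) (H'.prob s p)) := by
  rw [← sum_joint_mul_ppl_sub, ← Finset.sum_add_distrib]
  refine Finset.sum_le_sum fun d _ => ?_
  rw [← mul_add]
  refine mul_le_mul_of_nonneg_left ?_ (Finset.prod_nonneg fun s _ => (L.prob_pos _ _ _).le)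
  linarith [hCR d]
end

section
/- Theorem A.1 (LLM-generated texts have lower expected perplexity): let d^H : Fin S → Σ be a fixed document, let ε ≥ 0 be a real number, and let B, H, B', H', L be autoregressive models over Σ of length S. Assume: (Semantic Superiority) PPL(d^H, H) ≤ PPL(d^H, B); (Conditional Redundancy) for every document d : Fin S → Σ, PPL(d, H') ≤ PPL(d^H, H); (Bounded Perplexity) for every document d : Fin S → Σ, PPL(d, B) − PPL(d, B') ≤ ε; and (KL alignment) for every s < S and every prefix p : Fin s → Σ, D_KL( L_s(·|p) ‖ B'_s(·|p) ) + ε ≤ D_KL( L_s(·|p) ‖ H'_s(·|p) ). Then ∑_{d : Fin S → Σ} P_L(d) · ( PPL(d, B) − PPL(d^H, B) ) ≤ 0. -/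
open Finset

theorem prefixOf_snoc_castSucc {Tok : Type*} {S : ℕ} (d : Fin S → Tok) (x : Tok) (s : Fin S) :
    prefixOf (Fin.snoc (α := fun _ => Tok) d x) s.castSucc = prefixOf d s := by
  funext t
  exact Fin.snoc_castSucc (α := fun _ => Tok) x d ⟨t.1, t.2.trans s.isLt⟩

theorem prefixOf_snoc_last {Tok : Type*} {S : ℕ} (d : Fin S → Tok) (x : Tok) :
    prefixOf (Fin.snoc (α := fun _ => Tok) d x) (Fin.last S) = d := by
  funext t
  exact Fin.snoc_castSucc (α := fun _ => Tok) x d t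

namespace ARModel

variable {Tok : Type*} [Fintype Tok] {S : ℕ}

/-- The model of the first `S` tokens of a document of length `S + 1`. -/
def truncate (M : ARModel Tok (S + 1)) : ARModel Tok S where
  prob s p x := M.prob s.castSucc p x
  prob_pos s p x := M.prob_pos s.castSucc p x
  sum_prob s p := M.sum_prob s.castSucc p

theorem joint_nonneg (M : ARModel Tok S) (d : Fin S → Tok) : 0 ≤ joint M d :=
  prod_nonneg fun s _ => (M.prob_pos s _ _).le

theorem joint_snoc (M : ARModel Tok (S + 1)) (d : Fin S → Tok) (x : Tok) :
    joint M (Fin.snoc (α := fun _ => Tok) d x) =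
      joint M.truncate d * M.prob (Fin.last S) d x := by
  unfold joint
  rw [Fin.prod_univ_castSucc, prefixOf_snoc_last, Fin.snoc_last]
  simp only [prefixOf_snoc_castSucc, Fin.snoc_castSucc]
  rfl

theorem sum_joint_mul_succ (M : ARModel Tok (S + 1)) (F : (Fin (S + 1) → Tok) → ℝ) :
    ∑ d, joint M d * F d =
      ∑ d, joint M.truncate d *
        ∑ x, M.prob (Fin.last S) d x * F (Fin.snoc (α := fun _ => Tok) d x) := by
  rw [← (Fin.snocEquiv fun _ => Tok).sum_comp, Fintype.sum_prod_type_right]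
  refine sum_congr rfl fun d _ => ?_
  rw [mul_sum]
  refine sum_congr rfl fun x _ => ?_
  simp only [Fin.snocEquiv, Equiv.coe_fn_mk]
  rw [joint_snoc, mul_assoc]

/-- A sum of token scores has nonnegative expectation if every conditional expectation is
nonnegative. -/
theorem sum_joint_mul_sum_nonneg (M : ARModel Tok S)
    (g : ∀ s : Fin S, (Fin s → Tok) → Tok → ℝ)
    (hg : ∀ s p, 0 ≤ ∑ x, M.prob s p x * g s p x) :
    0 ≤ ∑ d, joint M d * ∑ s, g s (prefixOf d s) (d s) := by
  induction S with
  | zero => simp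
  | succ S ih =>
    rw [sum_joint_mul_succ]
    simp only [Fin.sum_univ_castSucc (n := S), prefixOf_snoc_last, prefixOf_snoc_castSucc,
      Fin.snoc_last, Fin.snoc_castSucc, mul_add, sum_add_distrib, ← sum_mul, sum_prob, one_mul]
    exact add_nonneg (ih M.truncate (fun s => g s.castSucc) fun s => hg s.castSucc)
      (sum_nonneg fun d _ => mul_nonneg (M.truncate.joint_nonneg d) (hg (Fin.last S) d))

theorem klDiv_sub_klDiv (L P Q : ARModel Tok S) (s : Fin S) (p : Fin s → Tok) :
    klDiv (L.prob s p) (Q.prob s p) - klDiv (L.prob s p) (P.prob s p) =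
      ∑ x, L.prob s p x * (Real.log (P.prob s p x) - Real.log (Q.prob s p x)) := by
  unfold klDiv
  rw [← sum_sub_distrib]
  refine sum_congr rfl fun x _ => ?_
  rw [Real.log_div (L.prob_pos s p x).ne' (Q.prob_pos s p x).ne',
    Real.log_div (L.prob_pos s p x).ne' (P.prob_pos s p x).ne']
  ring

/-- A uniform gap between conditional KL divergences carries over to expected perplexities. -/
theorem sum_joint_mul_ppl_gap_nonneg (hS : 1 ≤ S) (ε : ℝ) (L P Q : ARModel Tok S)
    (hKL : ∀ (s : Fin S) (p : Fin s → Tok),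
      klDiv (L.prob s p) (P.prob s p) + ε ≤ klDiv (L.prob s p) (Q.prob s p)) :
    0 ≤ ∑ d, joint L d * (ppl Q d - ppl P d - ε) := by
  have hS0 : (S : ℝ) ≠ 0 := by positivity
  have key := L.sum_joint_mul_sum_nonneg
    (fun s p x => Real.log (P.prob s p x) - Real.log (Q.prob s p x) - ε) fun s p => by
      simp only [mul_sub _ _ ε, sum_sub_distrib, ← sum_mul, sum_prob, one_mul,
        ← klDiv_sub_klDiv]
      linarith [hKL s p]
  refine (mul_nonneg (by positivity : (0 : ℝ) ≤ 1 / S) key).trans_eq ?_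
  rw [mul_sum]
  refine sum_congr rfl fun d _ => ?_
  simp only [ppl, sum_sub_distrib, sum_const, card_univ, Fintype.card_fin, nsmul_eq_mul]
  field_simp
  ring

end ARModel

/-- Theorem A.1: LLM-generated texts have lower expected perplexity. -/
theorem llm_lower_expected_ppl {Tok : Type*} [Fintype Tok] [DecidableEq Tok] [Nonempty Tok]
    {S : ℕ} (hS : 1 ≤ S) (dH : Fin S → Tok) (ε : ℝ) (hε : 0 ≤ ε)
    (B H B' H' L : ARModel Tok S)
    (hSS : ppl H dH ≤ ppl B dH)
    (hCR : ∀ d : Fin S → Tok, ppl H' d ≤ ppl H dH)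
    (hBP : ∀ d : Fin S → Tok, ppl B d - ppl B' d ≤ ε)
    (hKL : ∀ (s : Fin S) (p : Fin s → Tok),
        klDiv (L.prob s p) (B'.prob s p) + ε ≤ klDiv (L.prob s p) (H'.prob s p)) :
    ∑ d : Fin S → Tok, joint L d * (ppl B d - ppl B dH) ≤ 0 := by
  refine le_trans ?_ (neg_nonpos.mpr (L.sum_joint_mul_ppl_gap_nonneg hS ε B' H' hKL))
  rw [← sum_neg_distrib]
  refine sum_le_sum fun d _ => ?_
  rw [← mul_neg]
  exact mul_le_mul_of_nonneg_left (by linarith [hCR d, hBP d]) (L.joint_nonneg d)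
end
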